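/- Let (F, M) be a Euclidean lattice. Suppose that for every orthogonal isodual Euclidean lattice (E, L, τ), H_min of the tensor product of (E, L) and (F, M) equals H_min(E, L)·H_min(F, M). Then the same equality holds for every Euclidean lattice (E, L). The same conclusion holds if the hypothesis is instead assumed for every symplectic isodual Euclidean lattice, or for every isodual Euclidean lattice. -/

import Mathlib

open Module

noncomputable section

namespace EucLat

variable {E : Type*} [NormedAddCommGroup E] [InnerProductSpace ℝ E]

/-- The covolume of a `ℤ`-submodule of a real inner product space: the square root of the
Gram determinant of a `ℤ`-basis (junk value `0` if no finite basis exists). -/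
def covol (L : Submodule ℤ E) : ℝ :=
  @dite _ (∃ n : ℕ, Nonempty (Basis (Fin n) ℤ L)) (Classical.propDecidable _)
    (fun h => Real.sqrt (Matrix.det (Matrix.of fun i j =>
      (inner ℝ ((h.choose_spec.some i : L) : E) ((h.choose_spec.some j : L) : E) : ℝ))))
    (fun _ => 0)

/-- The reduced height `covol(L)^(1/dim E)` of a full lattice. -/
def redH (L : Submodule ℤ E) : ℝ := covol L ^ ((finrank ℝ E : ℝ)⁻¹)

/-- The lattice `L ∩ F` induced on a subspace `F`. -/
def latIn (L : Submodule ℤ E) (F : Submodule ℝ E) : Submodule ℤ F :=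
  L.comap (F.subtype.restrictScalars ℤ)

/-- The reduced height of a subspace: `covol(F ∩ L)^(1/dim F)`. -/
def Hr (L : Submodule ℤ E) (F : Submodule ℝ E) : ℝ := redH (latIn L F)

/-- A subspace is rational if it is spanned by its intersection with the lattice. -/
def IsRational (L : Submodule ℤ E) (F : Submodule ℝ E) : Prop :=
  Submodule.span ℝ ((L : Set E) ∩ (F : Set E)) = F

/-- `(E, L)` is a Euclidean lattice: `L` is discrete and spans `E` over `ℝ`. -/
def IsLat (L : Submodule ℤ E) : Prop :=
  DiscreteTopology L ∧ Submodule.span ℝ (L : Set E) = ⊤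

/-- Minimal reduced height: infimum of reduced heights of nonzero rational subspaces. -/
def Hmin (L : Submodule ℤ E) : ℝ :=
  sInf {h : ℝ | ∃ F : Submodule ℝ E, F ≠ ⊥ ∧ IsRational L F ∧ h = Hr L F}

/-- Semistability of a Euclidean lattice. -/
def Semistable (L : Submodule ℤ E) : Prop :=
  ∀ F : Submodule ℝ E, F ≠ ⊥ → IsRational L F → redH L ≤ Hr L F

/-- Stability of a Euclidean lattice. -/
def Stable (L : Submodule ℤ E) : Prop :=
  Semistable L ∧ ∀ F : Submodule ℝ E, F ≠ ⊥ → F ≠ ⊤ → IsRational L F → redH L < Hr L F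

/-- The quotient lattice of `(E, L)` by a subspace `F`: the image of `L` under the
orthogonal projection of `E` onto `Fᗮ`. -/
def quotLat [FiniteDimensional ℝ E] (L : Submodule ℤ E) (F : Submodule ℝ E) :
    Submodule ℤ Fᗮ :=
  L.map ((Submodule.orthogonalProjectionOnto Fᗮ : E →ₗ[ℝ] Fᗮ).restrictScalars ℤ)

/-- For subspaces `F ≤ F'`, the successive quotient lattice: the image of `F' ∩ L` under the
orthogonal projection of `F'` onto the orthogonal complement of `F` inside `F'`. -/
def succQuot [FiniteDimensional ℝ E] (L : Submodule ℤ E) (F F' : Submodule ℝ E) :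
    Submodule ℤ ((F.comap F'.subtype)ᗮ) :=
  quotLat (latIn L F') (F.comap F'.subtype)

/-- A GS-flag of `(E, L)`. -/
def IsGSFlag [FiniteDimensional ℝ E] (L : Submodule ℤ E) {ℓ : ℕ}
    (C : Fin (ℓ + 1) → Submodule ℝ E) : Prop :=
  C 0 = ⊥ ∧ C (Fin.last ℓ) = ⊤ ∧
  (∀ i : Fin ℓ, C i.castSucc < C i.succ) ∧
  (∀ i, IsRational L (C i)) ∧
  (∀ i : Fin ℓ, Semistable (succQuot L (C i.castSucc) (C i.succ))) ∧
  (∀ i j : Fin ℓ, i < j →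
    redH (succQuot L (C i.castSucc) (C i.succ)) < redH (succQuot L (C j.castSucc) (C j.succ)))

/-- The dual lattice `L* = {y : ⟪x, y⟫ ∈ ℤ for all x ∈ L}`. -/
def dualLat (L : Submodule ℤ E) : Submodule ℤ E where
  carrier := {y | ∀ x ∈ L, ∃ n : ℤ, (inner ℝ x y : ℝ) = n}
  zero_mem' := fun x _ => ⟨0, by simp⟩
  add_mem' := by
    intro a b ha hb x hx
    obtain ⟨m, hm⟩ := ha x hx
    obtain ⟨n, hn⟩ := hb x hx
    exact ⟨m + n, by rw [inner_add_right, hm, hn]; push_cast; ring⟩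
  smul_mem' := by
    intro z y hy x hx
    obtain ⟨n, hn⟩ := hy x hx
    refine ⟨z * n, ?_⟩
    rw [← Int.cast_smul_eq_zsmul ℝ, real_inner_smul_right, hn]
    push_cast; ring

/-- `(E, L)` is isodual via the similarity `τ`. -/
def IsIsodual (L : Submodule ℤ E) (τ : E →ₗ[ℝ] E) : Prop :=
  (∃ α : ℝ, 0 < α ∧ ∀ x y : E, (inner ℝ (τ x) (τ y) : ℝ) = α * inner ℝ x y) ∧
  L.map (τ.restrictScalars ℤ) = dualLat L

/-- The bilinear form `b_τ(x, y) = ⟪τ x, y⟫` associated with an isoduality. -/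
def bform (τ : E →ₗ[ℝ] E) (x y : E) : ℝ := inner ℝ (τ x) y

/-- `b` has signature `s`: there is a `b`-orthogonal basis with `p - q = s`. -/
def HasSignature (b : E → E → ℝ) (s : ℤ) : Prop :=
  ∃ (n : ℕ) (v : Basis (Fin n) ℝ E),
    (∀ i j, i ≠ j → b (v i) (v j) = 0) ∧
    s = ((Finset.univ.filter fun i => 0 < b (v i) (v i)).card : ℤ) -
        ((Finset.univ.filter fun i => b (v i) (v i) < 0).card : ℤ)

/-- The destabilizing subspace of `(E, L)`. -/
def IsDestabilizing (L : Submodule ℤ E) (F : Submodule ℝ E) : Prop :=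
  F ≠ ⊥ ∧ IsRational L F ∧ Hr L F = Hmin L ∧
  ∀ F' : Submodule ℝ E, F' ≠ ⊥ → IsRational L F' → Hr L F' = Hmin L → F' ≤ F

/-- `(G, t)` is a realization of the tensor product of the inner product spaces `E` and `F`:
`t` induces a linear isomorphism `E ⊗ F ≃ G` and
`⟪t x y, t x' y'⟫ = ⟪x, x'⟫ * ⟪y, y'⟫` on pure tensors. -/
def IsTensor {F G : Type*} [NormedAddCommGroup F] [InnerProductSpace ℝ F]
    [NormedAddCommGroup G] [InnerProductSpace ℝ G] (t : E →ₗ[ℝ] F →ₗ[ℝ] G) : Prop :=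
  Function.Bijective (TensorProduct.lift t) ∧
  ∀ (x x' : E) (y y' : F),
    (inner ℝ (t x y) (t x' y') : ℝ) = (inner ℝ x x' : ℝ) * (inner ℝ y y' : ℝ)

/-- The tensor product lattice `L·M`: the additive subgroup generated by pure tensors. -/
def tensorLat {F G : Type*} [NormedAddCommGroup F] [InnerProductSpace ℝ F]
    [NormedAddCommGroup G] [InnerProductSpace ℝ G] (t : E →ₗ[ℝ] F →ₗ[ℝ] G)
    (L : Submodule ℤ E) (M : Submodule ℤ F) : Submodule ℤ G :=
  Submodule.span ℤ (Set.image2 (fun x y => t x y) (L : Set E) (M : Set F))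

/-- `g` is an automorphism of the Euclidean lattice `(E, L)`. -/
def IsAut (L : Submodule ℤ E) (g : E ≃ₗ[ℝ] E) : Prop :=
  (∀ x, x ∈ L ↔ g x ∈ L) ∧ ∀ x y : E, (inner ℝ (g x) (g y) : ℝ) = inner ℝ x y

/-- The direct product lattice `L × L'` inside `WithLp 2 (E × E')`. -/
def prodLat {E' : Type*} [NormedAddCommGroup E'] [InnerProductSpace ℝ E']
    (L : Submodule ℤ E) (L' : Submodule ℤ E') : Submodule ℤ (WithLp 2 (E × E')) :=
  (L.prod L').comap (((WithLp.linearEquiv 2 ℝ (E × E')).restrictScalars ℤ) : WithLp 2 (E × E') →ₗ[ℤ] E × E')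


open Matrix in
lemma det_one_add_psd {n : Type*} [Fintype n] [DecidableEq n] {P : Matrix n n ℝ}
    (hP : P.PosSemidef) : 1 ≤ (1 + P).det := by
  have hH : (1 + P).IsHermitian := isHermitian_one.add hP.1
  rw [hH.det_eq_prod_eigenvalues]
  refine Finset.one_le_prod ?_
  intro i _
  have hu := hH.eigenvectorBasis.orthonormal.1 i
  have h1 := hH.eigenvalues_eq i
  rw [RCLike.ofReal_real_eq_id, id, h1, add_mulVec, dotProduct_add, one_mulVec]
  have h2 := hP.dotProduct_mulVec_nonneg (hH.eigenvectorBasis i).ofLp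
  have h3 : star (hH.eigenvectorBasis i).ofLp ⬝ᵥ (hH.eigenvectorBasis i).ofLp = 1 := by
    have := EuclideanSpace.inner_eq_star_dotProduct (hH.eigenvectorBasis i) (hH.eigenvectorBasis i)
    rw [real_inner_self_eq_norm_sq, hu] at this
    rw [dotProduct_comm, ← this]; norm_num
  simp only [RCLike.re_to_real]
  linarith

open Matrix MatrixOrder Matrix.Norms.L2Operator in
lemma det_le_det_add {n : Type*} [Fintype n] [DecidableEq n] {P Q : Matrix n n ℝ}
    (hQ : Q.PosDef) (hP : P.PosSemidef) : Q.det ≤ (Q + P).det := by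
  obtain ⟨B, hB, rfl⟩ := CStarAlgebra.isStrictlyPositive_iff_eq_star_mul_self.mp hQ.isStrictlyPositive
  rw [star_eq_conjTranspose]
  have hBd : IsUnit B.det := (Matrix.isUnit_iff_isUnit_det _).1 hB
  have h1 : (B⁻¹ᴴ * P * B⁻¹).PosSemidef := hP.conjTranspose_mul_mul_same _
  have h2 : Bᴴ * B + P = Bᴴ * (1 + B⁻¹ᴴ * P * B⁻¹) * B := by
    have h3 : Bᴴ * B⁻¹ᴴ = 1 := by
      rw [← conjTranspose_mul, nonsing_inv_mul _ hBd, conjTranspose_one]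
    have h4 : B⁻¹ * B = 1 := nonsing_inv_mul _ hBd
    rw [Matrix.mul_add, Matrix.add_mul, Matrix.mul_one]
    congr 1
    calc P = (Bᴴ * B⁻¹ᴴ) * P * (B⁻¹ * B) := by rw [h3, h4]; simp
      _ = _ := by simp only [Matrix.mul_assoc]
  rw [h2, det_mul, det_mul, det_mul, det_conjTranspose]
  have := det_one_add_psd h1
  have h5 : 0 ≤ star B.det * B.det := by simpa using mul_self_nonneg B.det
  nlinarith

open Matrix in
lemma quad_gram {E : Type*} [NormedAddCommGroup E] [InnerProductSpace ℝ E] {n : Type*} [Fintype n]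
    (y : n → E) (x : n → ℝ) :
    star x ⬝ᵥ (gram ℝ y *ᵥ x) = ‖∑ i, x i • y i‖ ^ 2 := by
  rw [star_dotProduct_gram_mulVec, real_inner_self_eq_norm_sq]

open Matrix in
lemma gram_mono {E E' : Type*} [NormedAddCommGroup E] [InnerProductSpace ℝ E]
    [NormedAddCommGroup E'] [InnerProductSpace ℝ E'] {n : Type*} [Fintype n] [DecidableEq n]
    (y : n → E) (z : n → E') (ε : ℝ) (hε : 0 < ε)
    (h : ∀ x : n → ℝ, ε * ‖∑ i, x i • z i‖ ^ 2 ≤ ‖∑ i, x i • y i‖ ^ 2)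
    (hz : (gram ℝ z).det ≠ 0) :
    ε ^ Fintype.card n * (gram ℝ z).det ≤ (gram ℝ y).det := by
  have h1 : (gram ℝ z).PosDef := (posSemidef_gram ℝ z).posDef_iff_det_ne_zero.2 hz
  have h2 : (ε • gram ℝ z).PosDef := h1.smul hε
  have h3 : (gram ℝ y - ε • gram ℝ z).PosSemidef := by
    refine PosSemidef.of_dotProduct_mulVec_nonneg ((posSemidef_gram ℝ y).1.sub h2.1) ?_
    intro x
    rw [sub_mulVec, dotProduct_sub, smul_mulVec, dotProduct_smul, quad_gram, quad_gram]
    have := h x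
    simpa using this
  have := det_le_det_add h2 h3
  rwa [add_sub_cancel, det_smul] at this

/-- Gram determinant lower bound for integral independent families. -/
def GramBd {E : Type*} [NormedAddCommGroup E] [InnerProductSpace ℝ E] (K : Submodule ℤ E)
    (ε : ℝ) : Prop :=
  ∀ (l : ℕ) (y : Fin l → E), (∀ j, y j ∈ K) → LinearIndependent ℤ y →
    ε ^ l ≤ (Matrix.gram ℝ y).det

open Matrix in
lemma exists_gramBd {E : Type*} [NormedAddCommGroup E] [InnerProductSpace ℝ E] {ι : Type*}
    [Fintype ι] (b : Basis ι ℝ E) (K : Submodule ℤ E)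
    (hK : K ≤ Submodule.span ℤ (Set.range b)) : ∃ ε > 0, GramBd K ε := by
  classical
  have : FiniteDimensional ℝ E := b.finiteDimensional_of_finite
  let T0 : E →ₗ[ℝ] EuclideanSpace ℝ ι :=
    (WithLp.linearEquiv 2 ℝ (ι → ℝ)).symm.toLinearMap ∘ₗ b.equivFun.toLinearMap
  let T : E →L[ℝ] EuclideanSpace ℝ ι := LinearMap.toContinuousLinearMap T0
  have hT : ∀ v i, T v i = b.repr v i := fun v i => rfl
  have hTi : Function.Injective T := by
    intro u v huv
    apply b.repr.injective
    ext i
    rw [← hT, ← hT, huv]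
  refine ⟨((‖T‖ + 1) ^ 2)⁻¹, by positivity, ?_⟩
  intro l y hy hli
  have hc : ∀ j, ∃ V : ι → ℤ, ∀ i, b.repr (y j) i = V i := by
    intro j
    have := (b.mem_span_iff_repr_mem ℤ _).1 (hK (hy j))
    choose V hV using this
    exact ⟨V, fun i => by rw [← hV i]; simp⟩
  choose V hV using hc
  let A : Matrix ι (Fin l) ℤ := Matrix.of fun i j => V j i
  have hgr : gram ℝ (fun j => T (y j)) = (Aᵀ * A).map (Int.cast : ℤ → ℝ) := by
    ext j k
    simp only [gram_apply, PiLp.inner_apply, hT, hV, Matrix.map_apply, Matrix.mul_apply, A,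
      Matrix.transpose_apply, Matrix.of_apply]
    push_cast
    exact Finset.sum_congr rfl fun i _ => by simp [mul_comm]
  have hdet : (gram ℝ (fun j => T (y j))).det = ((Aᵀ * A).det : ℝ) := by
    rw [hgr]
    exact (RingHom.map_det (Int.castRingHom ℝ) _).symm
  have hne : (Aᵀ * A).det ≠ 0 := by
    intro h0
    obtain ⟨x, hx, hx0⟩ := (Matrix.exists_mulVec_eq_zero_iff).2 h0
    have h1 : (A *ᵥ x) ⬝ᵥ (A *ᵥ x) = 0 := by
      have : x ⬝ᵥ ((Aᵀ * A) *ᵥ x) = 0 := by rw [hx0]; simp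
      rwa [← mulVec_mulVec, dotProduct_mulVec, vecMul_transpose] at this
    rw [dotProduct_self_eq_zero] at h1
    apply hx
    have h2 : ∑ j, x j • y j = 0 := by
      apply b.repr.injective
      ext i
      have := congrFun h1 i
      simp only [mulVec, dotProduct, A, Matrix.of_apply, Pi.zero_apply] at this
      have h3 : ((∑ j, V j i * x j : ℤ) : ℝ) = 0 := by rw [this]; simp
      rw [map_sum, map_zero, Finsupp.finsetSum_apply, Finsupp.zero_apply, ← h3]
      push_cast
      refine Finset.sum_congr rfl fun j _ => ?_
      rw [← Int.cast_smul_eq_zsmul ℝ, map_smul, Finsupp.smul_apply, hV, smul_eq_mul, mul_comm]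
    exact funext (Fintype.linearIndependent_iff.1 hli x h2)
  have hge : (1 : ℝ) ≤ (gram ℝ (fun j => T (y j))).det := by
    have h0 := (posSemidef_gram ℝ (fun j => T (y j))).det_nonneg
    rw [hdet] at h0 ⊢
    have h0' : 0 ≤ (Aᵀ * A).det := by exact_mod_cast h0
    have : 1 ≤ (Aᵀ * A).det := by omega
    exact_mod_cast this
  have hε : 0 < ((‖T‖ + 1) ^ 2)⁻¹ := by positivity
  have := gram_mono y (fun j => T (y j)) _ hε ?_ (by positivity)
  · rw [Fintype.card_fin] at this
    refine le_trans ?_ this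
    have hp : 0 < ((‖T‖ + 1) ^ 2)⁻¹ ^ l := by positivity
    nlinarith
  · intro x
    have : ∑ i, x i • T (y i) = T (∑ i, x i • y i) := by simp
    rw [this, inv_mul_le_iff₀ (by positivity), ← mul_pow]
    gcongr
    refine (T.le_opNorm _).trans ?_
    gcongr
    linarith

open Matrix in
lemma gram_change {E : Type*} [NormedAddCommGroup E] [InnerProductSpace ℝ E] {ι : Type*}
    [Fintype ι] [DecidableEq ι] (L : Submodule ℤ E) (b b' : Basis ι ℤ L) :
    (gram ℝ (fun i => (b' i : E))).det = (gram ℝ (fun i => (b i : E))).det := by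
  let P : Matrix ι ι ℤ := b.toMatrix b'
  let Q : Matrix ι ι ℝ := P.map (Int.cast : ℤ → ℝ)
  have h1 : ∀ i, (b' i : E) = ∑ j, Q j i • (b j : E) := by
    intro i
    have := b.sum_toMatrix_smul_self b' i
    have h := congrArg (L.subtype) this
    simp only [map_sum, map_zsmul, Submodule.subtype_apply] at h
    rw [← h]
    refine Finset.sum_congr rfl fun j _ => ?_
    rw [← Int.cast_smul_eq_zsmul ℝ]; rfl
  have h2 : gram ℝ (fun i => (b' i : E)) = Qᵀ * gram ℝ (fun i => (b i : E)) * Q := by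
    ext i k
    simp only [gram_apply, Matrix.mul_apply, Matrix.transpose_apply]
    rw [h1 i, h1 k, sum_inner]
    simp_rw [inner_sum, real_inner_smul_left, real_inner_smul_right, Finset.sum_mul]
    rw [Finset.sum_comm]
    refine Finset.sum_congr rfl fun j _ => Finset.sum_congr rfl fun l _ => by ring
  have h3 : Q.det = (P.det : ℝ) := (RingHom.map_det (Int.castRingHom ℝ) _).symm
  have h4 : IsUnit P.det := by
    rw [← Matrix.isUnit_iff_isUnit_det]
    have := b.invertibleToMatrix b'
    exact isUnit_of_invertible P
  have h5 : Q.det * Q.det = 1 := by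
    rw [h3]
    rcases Int.isUnit_iff.1 h4 with h | h <;> rw [h] <;> norm_num
  rw [h2, det_mul, det_mul, det_transpose]
  linear_combination (gram ℝ (fun i => (b i : E))).det * h5

open Matrix in
lemma covol_eq {E : Type*} [NormedAddCommGroup E] [InnerProductSpace ℝ E] {ι : Type*}
    [Fintype ι] [DecidableEq ι] (L : Submodule ℤ E) (b : Basis ι ℤ L) :
    covol L = Real.sqrt (gram ℝ (fun i => (b i : E))).det := by
  have h : ∃ n : ℕ, Nonempty (Basis (Fin n) ℤ L) :=
    ⟨_, ⟨b.reindex (Fintype.equivFin ι)⟩⟩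
  rw [covol, dif_pos h]
  congr 1
  change (gram ℝ (fun i => (h.choose_spec.some i : E))).det = _
  let b0 := h.choose_spec.some
  let e : Fin h.choose ≃ ι := b0.indexEquiv b
  rw [← gram_change L b (b0.reindex e)]
  rw [← det_submatrix_equiv_self e]
  congr 1
  ext i j
  simp [gram_apply, b0]

def latInEquiv {E : Type*} [NormedAddCommGroup E] [InnerProductSpace ℝ E] (L : Submodule ℤ E)
    (W : Submodule ℝ E) : ↥(L ⊓ W.restrictScalars ℤ) ≃ₗ[ℤ] latIn L W where
  toFun x := ⟨⟨x.1, x.2.2⟩, x.2.1⟩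
  invFun x := ⟨x.1.1, x.2, x.1.2⟩
  map_add' _ _ := rfl
  map_smul' _ _ := rfl
  left_inv _ := rfl
  right_inv _ := rfl

open Matrix in
lemma covol_latIn {E : Type*} [NormedAddCommGroup E] [InnerProductSpace ℝ E] {ι : Type*}
    [Fintype ι] [DecidableEq ι] (L : Submodule ℤ E) (W : Submodule ℝ E)
    (v : Basis ι ℤ ↥(L ⊓ W.restrictScalars ℤ)) :
    covol (latIn L W) = Real.sqrt (gram ℝ (fun i => (v i : E))).det := by
  rw [covol_eq _ (v.map (latInEquiv L W))]
  rfl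

lemma isLat_latIn {E : Type*} [NormedAddCommGroup E] [InnerProductSpace ℝ E]
    (L : Submodule ℤ E) (hL : DiscreteTopology L) (W : Submodule ℝ E)
    (hW : IsRational L W) : IsLat (latIn L W) := by
  refine ⟨ZLattice.comap_discreteTopology ℝ L (e := W.subtype) continuous_subtype_val
    Subtype.val_injective, ?_⟩
  apply Submodule.map_injective_of_injective (f := W.subtype) Subtype.val_injective
  rw [Submodule.map_span, Submodule.map_top, Submodule.range_subtype]
  conv_rhs => rw [← hW]
  congr 1
  ext x
  constructor
  · rintro ⟨y, hy, rfl⟩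
    exact ⟨hy, y.2⟩
  · rintro ⟨h1, h2⟩
    exact ⟨⟨x, h2⟩, h1, rfl⟩

lemma card_latIn {E : Type*} [NormedAddCommGroup E] [InnerProductSpace ℝ E]
    [FiniteDimensional ℝ E] {ι : Type*}
    [Fintype ι] (L : Submodule ℤ E) (hL : DiscreteTopology L) (W : Submodule ℝ E)
    (hW : IsRational L W) (v : Basis ι ℤ ↥(L ⊓ W.restrictScalars ℤ)) :
    finrank ℝ W = Fintype.card ι := by
  obtain ⟨h1, h2⟩ := isLat_latIn L hL W hW
  have : IsZLattice ℝ (latIn L W) := ⟨h2⟩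
  rw [← ZLattice.rank ℝ (latIn L W), finrank_eq_card_basis (v.map (latInEquiv L W))]

lemma exists_basis {E : Type*} [NormedAddCommGroup E] [InnerProductSpace ℝ E]
    [FiniteDimensional ℝ E] (L : Submodule ℤ E) (hL : DiscreteTopology L)
    (W : Submodule ℤ E) : ∃ k, Nonempty (Basis (Fin k) ℤ ↥(L ⊓ W)) := by
  have : DiscreteTopology ↥(L ⊓ W) :=
    DiscreteTopology.of_subset (s := (L : Set E)) hL (fun x hx => hx.1)
  exact ⟨_, ⟨finBasis ℤ ↥(L ⊓ W)⟩⟩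

lemma Hr_nonneg {E : Type*} [NormedAddCommGroup E] [InnerProductSpace ℝ E]
    (L : Submodule ℤ E) (W : Submodule ℝ E) : 0 ≤ Hr L W := by
  unfold Hr redH
  apply Real.rpow_nonneg
  unfold covol
  split
  · exact Real.sqrt_nonneg _
  · exact le_rfl

lemma Hmin_le {E : Type*} [NormedAddCommGroup E] [InnerProductSpace ℝ E]
    (L : Submodule ℤ E) (W : Submodule ℝ E) (h : W ≠ ⊥) (hW : IsRational L W) :
    Hmin L ≤ Hr L W := by
  apply csInf_le
  · refine ⟨0, ?_⟩
    rintro _ ⟨F, -, -, rfl⟩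
    exact Hr_nonneg _ _
  · exact ⟨W, h, hW, rfl⟩

lemma Hmin_nonneg {E : Type*} [NormedAddCommGroup E] [InnerProductSpace ℝ E]
    (L : Submodule ℤ E) : 0 ≤ Hmin L := by
  apply Real.sInf_nonneg
  rintro _ ⟨F, -, -, rfl⟩
  exact Hr_nonneg _ _

open Matrix in
lemma Hmin_pow_le {E : Type*} [NormedAddCommGroup E] [InnerProductSpace ℝ E]
    [FiniteDimensional ℝ E] (L : Submodule ℤ E) (hL : DiscreteTopology L) (A : Submodule ℝ E)
    (k : ℕ) (v : Basis (Fin k) ℤ ↥(L ⊓ A.restrictScalars ℤ)) :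
    Hmin L ^ k ≤ Real.sqrt (gram ℝ (fun i => (v i : E))).det := by
  rcases Nat.eq_zero_or_pos k with rfl | hk
  · simp
  let A' : Submodule ℝ E := Submodule.span ℝ ((L : Set E) ∩ A)
  have hA' : A' ≤ A := Submodule.span_le.2 fun x hx => hx.2
  have heq : L ⊓ A.restrictScalars ℤ = L ⊓ A'.restrictScalars ℤ := by
    apply le_antisymm
    · intro x hx
      exact ⟨hx.1, Submodule.subset_span hx⟩
    · intro x hx
      exact ⟨hx.1, hA' hx.2⟩
  have hrat : IsRational L A' := by
    apply le_antisymm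
    · exact Submodule.span_le.2 fun x hx => hx.2
    · exact Submodule.span_mono fun x hx => ⟨hx.1, Submodule.subset_span hx⟩
  let v' := v.map (LinearEquiv.ofEq _ _ heq)
  have hc := card_latIn L hL A' hrat v'
  rw [Fintype.card_fin] at hc
  have hne : A' ≠ ⊥ := by
    intro h
    rw [h, finrank_bot] at hc
    omega
  have h1 := Hmin_le L A' hne hrat
  have h2 := covol_latIn L A' v'
  have h3 : (fun i => (v' i : E)) = fun i => (v i : E) := rfl
  rw [h3] at h2
  rw [Hr, redH, hc, h2] at h1
  calc Hmin L ^ k ≤ _ := pow_le_pow_left₀ (Hmin_nonneg L) h1 k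
    _ = _ := Real.rpow_inv_natCast_pow (Real.sqrt_nonneg _) (by omega)

open Matrix in
lemma gram_block {E E' : Type*} [NormedAddCommGroup E] [InnerProductSpace ℝ E]
    [NormedAddCommGroup E'] [InnerProductSpace ℝ E'] {m n : Type*} [Fintype m] [Fintype n]
    [DecidableEq m] [DecidableEq n]
    (a : m → E) (x : n → E) (y : n → E') (z : m ⊕ n → WithLp 2 (E × E'))
    (ha : (gram ℝ a).det ≠ 0) (hy : (gram ℝ y).det ≠ 0)
    (h1 : ∀ i, z (Sum.inl i) = WithLp.toLp 2 (a i, 0))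
    (h2 : ∀ i, z (Sum.inr i) = WithLp.toLp 2 (x i, y i)) :
    (gram ℝ a).det * (gram ℝ y).det ≤ (gram ℝ z).det := by
  have hap : (gram ℝ a).PosDef := (posSemidef_gram ℝ a).posDef_iff_det_ne_zero.2 ha
  have hyp : (gram ℝ y).PosDef := (posSemidef_gram ℝ y).posDef_iff_det_ne_zero.2 hy
  let B : Matrix m n ℝ := of fun i j => inner ℝ (a i) (x j)
  have : Invertible (gram ℝ a) := hap.isUnit.invertible
  have e1 : gram ℝ (Sum.elim a x) = fromBlocks (gram ℝ a) B Bᴴ (gram ℝ x) := by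
    ext i j
    rcases i with i | i <;> rcases j with j | j <;> simp [gram_apply, B, real_inner_comm]
  have e2 : gram ℝ z = fromBlocks (gram ℝ a) B Bᴴ (gram ℝ x + gram ℝ y) := by
    ext i j
    rcases i with i | i <;> rcases j with j | j <;>
      simp [gram_apply, B, real_inner_comm, h1, h2, WithLp.prod_inner_apply]
  have h3 := (posSemidef_gram ℝ (Sum.elim a x))
  rw [e1, PosDef.fromBlocks₁₁ _ _ hap] at h3
  rw [e2, det_fromBlocks₁₁, invOf_eq_nonsing_inv]
  have h4 := det_le_det_add hyp h3
  have h5 : gram ℝ y + (gram ℝ x - Bᴴ * (gram ℝ a)⁻¹ * B) =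
    gram ℝ x + gram ℝ y - Bᴴ * (gram ℝ a)⁻¹ * B := by abel
  rw [h5] at h4
  exact mul_le_mul_of_nonneg_left h4 hap.det_pos.le

lemma mem_prodLat {E E' : Type*} [NormedAddCommGroup E] [InnerProductSpace ℝ E]
    [NormedAddCommGroup E'] [InnerProductSpace ℝ E'] (L : Submodule ℤ E) (K : Submodule ℤ E')
    (z : WithLp 2 (E × E')) : z ∈ prodLat L K ↔ z.fst ∈ L ∧ z.snd ∈ K := Iff.rfl

/-- First inclusion. -/
def inlL (E E' : Type*) [NormedAddCommGroup E] [InnerProductSpace ℝ E]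
    [NormedAddCommGroup E'] [InnerProductSpace ℝ E'] : E →ₗ[ℝ] WithLp 2 (E × E') :=
  (WithLp.linearEquiv 2 ℝ (E × E')).symm.toLinearMap ∘ₗ LinearMap.inl ℝ E E'

/-- Second inclusion. -/
def inrL (E E' : Type*) [NormedAddCommGroup E] [InnerProductSpace ℝ E]
    [NormedAddCommGroup E'] [InnerProductSpace ℝ E'] : E' →ₗ[ℝ] WithLp 2 (E × E') :=
  (WithLp.linearEquiv 2 ℝ (E × E')).symm.toLinearMap ∘ₗ LinearMap.inr ℝ E E'

/-- Second projection. -/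
def sndL (E E' : Type*) [NormedAddCommGroup E] [InnerProductSpace ℝ E]
    [NormedAddCommGroup E'] [InnerProductSpace ℝ E'] : WithLp 2 (E × E') →ₗ[ℝ] E' :=
  LinearMap.snd ℝ E E' ∘ₗ (WithLp.linearEquiv 2 ℝ (E × E')).toLinearMap

lemma inlL_apply {E E' : Type*} [NormedAddCommGroup E] [InnerProductSpace ℝ E]
    [NormedAddCommGroup E'] [InnerProductSpace ℝ E'] (x : E) :
    inlL E E' x = WithLp.toLp 2 (x, 0) := rfl

lemma inrL_apply {E E' : Type*} [NormedAddCommGroup E] [InnerProductSpace ℝ E]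
    [NormedAddCommGroup E'] [InnerProductSpace ℝ E'] (x : E') :
    inrL E E' x = WithLp.toLp 2 (0, x) := rfl

lemma inl_mem {E E' : Type*} [NormedAddCommGroup E] [InnerProductSpace ℝ E]
    [NormedAddCommGroup E'] [InnerProductSpace ℝ E'] (L : Submodule ℤ E) (K : Submodule ℤ E')
    (x : E) : inlL E E' x ∈ prodLat L K ↔ x ∈ L := by
  rw [mem_prodLat]
  exact ⟨fun h => h.1, fun h => ⟨h, K.zero_mem⟩⟩

lemma inr_mem {E E' : Type*} [NormedAddCommGroup E] [InnerProductSpace ℝ E]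
    [NormedAddCommGroup E'] [InnerProductSpace ℝ E'] (L : Submodule ℤ E) (K : Submodule ℤ E')
    (x : E') : inrL E E' x ∈ prodLat L K ↔ x ∈ K := by
  rw [mem_prodLat]
  exact ⟨fun h => h.2, fun h => ⟨L.zero_mem, h⟩⟩

lemma inl_add_inr {E E' : Type*} [NormedAddCommGroup E] [InnerProductSpace ℝ E]
    [NormedAddCommGroup E'] [InnerProductSpace ℝ E'] (z : WithLp 2 (E × E')) :
    inlL E E' z.fst + inrL E E' z.snd = z := by
  apply (WithLp.equiv 2 (E × E')).injective
  ext <;> simp [inlL_apply, inrL_apply]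

lemma isLat_prodLat {E E' : Type*} [NormedAddCommGroup E] [InnerProductSpace ℝ E]
    [NormedAddCommGroup E'] [InnerProductSpace ℝ E'] (L : Submodule ℤ E) (K : Submodule ℤ E')
    (hL : IsLat L) (hK : IsLat K) : IsLat (prodLat L K) := by
  obtain ⟨h1, h2⟩ := hL
  obtain ⟨h3, h4⟩ := hK
  constructor
  · have h5 : DiscreteTopology ↥((L : Set E) ×ˢ (K : Set E')) :=
      (Homeomorph.Set.prod (L : Set E) (K : Set E')).symm.discreteTopology
    exact DiscreteTopology.preimage_of_continuous_injective ((L : Set E) ×ˢ (K : Set E'))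
      (WithLp.prod_continuous_ofLp 2 E E') (WithLp.ofLp_injective 2)
  · rw [eq_top_iff]
    have k1 : Submodule.map (inlL E E') (Submodule.span ℝ (L : Set E)) ≤
        Submodule.span ℝ (prodLat L K : Set (WithLp 2 (E × E'))) := by
      rw [Submodule.map_span]
      refine Submodule.span_mono ?_
      rintro _ ⟨x, hx, rfl⟩
      exact (inl_mem L K x).2 hx
    have k2 : Submodule.map (inrL E E') (Submodule.span ℝ (K : Set E')) ≤
        Submodule.span ℝ (prodLat L K : Set (WithLp 2 (E × E'))) := by
      rw [Submodule.map_span]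
      refine Submodule.span_mono ?_
      rintro _ ⟨x, hx, rfl⟩
      exact (inr_mem L K x).2 hx
    rw [h2] at k1
    rw [h4] at k2
    intro z _
    rw [← inl_add_inr z]
    exact add_mem (k1 ⟨_, trivial, rfl⟩) (k2 ⟨_, trivial, rfl⟩)

lemma nonempty_set {E : Type*} [NormedAddCommGroup E] [InnerProductSpace ℝ E] [Nontrivial E]
    (L : Submodule ℤ E) (hL : IsLat L) :
    {h : ℝ | ∃ F : Submodule ℝ E, F ≠ ⊥ ∧ IsRational L F ∧ h = Hr L F}.Nonempty := by
  refine ⟨_, ⊤, ?_, ?_, rfl⟩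
  · exact top_ne_bot
  · unfold IsRational
    simpa using hL.2

def interEquiv {E E' : Type*} [NormedAddCommGroup E] [InnerProductSpace ℝ E]
    [NormedAddCommGroup E'] [InnerProductSpace ℝ E'] (L : Submodule ℤ E) (K : Submodule ℤ E')
    (F : Submodule ℝ E) : ↥(L ⊓ F.restrictScalars ℤ) ≃ₗ[ℤ]
      ↥(prodLat L K ⊓ (F.map (inlL E E')).restrictScalars ℤ) where
  toFun x := ⟨inlL E E' x.1, (inl_mem L K _).2 x.2.1, ⟨x.1, x.2.2, rfl⟩⟩
  invFun x := ⟨x.1.fst, ((mem_prodLat _ _ _).1 x.2.1).1, by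
    obtain ⟨y, hy, h⟩ := x.2.2
    rw [← h]
    exact hy⟩
  map_add' _ _ := Subtype.ext (map_add _ _ _)
  map_smul' c x := Subtype.ext (map_zsmul (inlL E E') c x.1)
  left_inv _ := rfl
  right_inv x := by
    apply Subtype.ext
    obtain ⟨y, hy, h⟩ := x.2.2
    change inlL E E' x.1.fst = x.1
    rw [← h]
    rfl

lemma Hmin_prod_le {E E' : Type*} [NormedAddCommGroup E] [InnerProductSpace ℝ E]
    [FiniteDimensional ℝ E] [Nontrivial E]
    [NormedAddCommGroup E'] [InnerProductSpace ℝ E'] (L : Submodule ℤ E) (K : Submodule ℤ E')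
    (hL : IsLat L) : Hmin (prodLat L K) ≤ Hmin L := by
  refine le_csInf (nonempty_set L hL) ?_
  rintro _ ⟨F, hF, hr, rfl⟩
  have hinj : Function.Injective (inlL E E') := fun x y h => congrArg WithLp.fst h
  have h1 : F.map (inlL E E') ≠ ⊥ := by
    intro h
    exact hF (Submodule.map_injective_of_injective hinj (h.trans (Submodule.map_bot _).symm))
  have h2 : IsRational (prodLat L K) (F.map (inlL E E')) := by
    unfold IsRational
    conv_rhs => rw [← hr, Submodule.map_span]
    congr 1
    ext z
    constructor
    · rintro ⟨hz, ⟨x, hx, rfl⟩⟩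
      exact ⟨x, ⟨(inl_mem L K x).1 hz, hx⟩, rfl⟩
    · rintro ⟨x, ⟨hx, hx'⟩, rfl⟩
      exact ⟨(inl_mem L K x).2 hx, ⟨x, hx', rfl⟩⟩
  refine (Hmin_le _ _ h1 h2).trans (le_of_eq ?_)
  obtain ⟨k, ⟨v⟩⟩ := exists_basis L hL.1 (F.restrictScalars ℤ)
  unfold Hr redH
  rw [← (Submodule.equivMapOfInjective _ hinj F).finrank_eq, covol_latIn L F v,
    covol_latIn _ _ (v.map (interEquiv L K F))]
  congr 3
  ext i j
  simp only [Matrix.gram_apply, Basis.map_apply]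
  change inner ℝ (inlL E E' (v i)) (inlL E E' (v j)) = _
  simp [inlL_apply, WithLp.prod_inner_apply]

def kerEquiv {E E' : Type*} [NormedAddCommGroup E] [InnerProductSpace ℝ E]
    [NormedAddCommGroup E'] [InnerProductSpace ℝ E'] (L : Submodule ℤ E) (K : Submodule ℤ E')
    (W : Submodule ℝ (WithLp 2 (E × E'))) :
    ↥(L ⊓ (W.comap (inlL E E')).restrictScalars ℤ) ≃ₗ[ℤ]
      ↥(LinearMap.ker ((sndL E E').restrictScalars ℤ ∘ₗ
        (prodLat L K ⊓ W.restrictScalars ℤ).subtype)) where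
  toFun x := ⟨⟨inlL E E' x.1, (inl_mem L K _).2 x.2.1, x.2.2⟩, rfl⟩
  invFun x := ⟨x.1.1.fst, ((mem_prodLat _ _ _).1 x.1.2.1).1, by
    have h : x.1.1.snd = 0 := x.2
    have h2 := inl_add_inr x.1.1
    rw [h, map_zero, add_zero] at h2
    change inlL E E' x.1.1.fst ∈ W
    rw [h2]
    exact x.1.2.2⟩
  map_add' _ _ := Subtype.ext (Subtype.ext (map_add _ _ _))
  map_smul' c x := Subtype.ext (Subtype.ext (map_zsmul (inlL E E') c x.1))
  left_inv _ := rfl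
  right_inv x := by
    apply Subtype.ext
    apply Subtype.ext
    have h : x.1.1.snd = 0 := x.2
    have h2 := inl_add_inr x.1.1
    rw [h, map_zero, add_zero] at h2
    exact h2

open Matrix in
lemma le_Hmin_prod {E E' : Type*} [NormedAddCommGroup E] [InnerProductSpace ℝ E]
    [FiniteDimensional ℝ E] [Nontrivial E]
    [NormedAddCommGroup E'] [InnerProductSpace ℝ E'] [FiniteDimensional ℝ E']
    (L : Submodule ℤ E) (K : Submodule ℤ E')
    (hL : IsLat L) (hK : IsLat K) (ε ε' : ℝ) (hε : 0 < ε) (hε' : 0 < ε')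
    (hLb : GramBd L ε') (hKb : GramBd K ε) (hm : Hmin L ^ 2 ≤ ε) :
    Hmin L ≤ Hmin (prodLat L K) := by
  have hLK := isLat_prodLat L K hL hK
  have : Nontrivial (WithLp 2 (E × E')) := (WithLp.equiv 2 (E × E')).nontrivial
  have : FiniteDimensional ℝ (WithLp 2 (E × E')) :=
    (WithLp.linearEquiv 2 ℝ (E × E')).symm.finiteDimensional
  refine le_csInf (nonempty_set _ hLK) ?_
  rintro _ ⟨W, hW, hr, rfl⟩
  let N := prodLat L K ⊓ W.restrictScalars ℤ
  let π : N →ₗ[ℤ] E' := (sndL E E').restrictScalars ℤ ∘ₗ N.subtype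
  obtain ⟨n, ⟨vN⟩⟩ := exists_basis _ hLK.1 (W.restrictScalars ℤ)
  obtain ⟨k, ⟨vS⟩⟩ := exists_basis L hL.1 ((W.comap (inlL E E')).restrictScalars ℤ)
  have hfin : Module.Finite ℤ N := Module.Finite.of_basis vN
  obtain ⟨l, ⟨vR⟩⟩ : ∃ l, Nonempty (Basis (Fin l) ℤ (LinearMap.range π)) := by
    have hle : LinearMap.range π ≤ K := by
      rintro _ ⟨x, rfl⟩
      exact ((mem_prodLat _ _ _).1 x.2.1).2
    obtain ⟨l, ⟨v⟩⟩ := exists_basis K hK.1 (LinearMap.range π)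
    exact ⟨l, ⟨v.map (LinearEquiv.ofEq _ _ (inf_eq_right.2 hle))⟩⟩
  let bW := vS.map (kerEquiv L K W)
  let bQ := vR.map π.quotKerEquivRange.symm
  let b : Basis (Fin k ⊕ Fin l) ℤ N := Basis.sumQuot bW bQ
  have hb1 : ∀ i, (b (Sum.inl i) : WithLp 2 (E × E')) = WithLp.toLp 2 ((vS i : E), 0) := by
    intro i
    have : b (Sum.inl i) = bW i := Basis.sumQuot_inl bW bQ i
    rw [this]
    rfl
  have hb2 : ∀ j, π (b (Sum.inr j)) = vR j := by
    intro j
    have h : Submodule.Quotient.mk (b (Sum.inr j)) = bQ j := Basis.sumQuot_inr bW bQ j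
    have h' := congrArg π.quotKerEquivRange h
    simp only [bQ, Basis.map_apply, LinearEquiv.apply_symm_apply] at h'
    exact congrArg Subtype.val h'
  have hyK : ∀ j, (vR j : E') ∈ K := by
    intro j
    rw [← hb2 j]
    exact ((mem_prodLat _ _ _).1 (b (Sum.inr j)).2.1).2
  have hyli : LinearIndependent ℤ (fun j => (vR j : E')) :=
    vR.linearIndependent.map' (LinearMap.range π).subtype (Submodule.ker_subtype _)
  have hali : LinearIndependent ℤ (fun j => (vS j : E)) :=
    vS.linearIndependent.map' (Submodule.subtype _) (Submodule.ker_subtype _)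
  have hdy := hKb l _ hyK hyli
  have hda := hLb k _ (fun i => (vS i).2.1) hali
  have hda' : 0 < (gram ℝ fun i => (vS i : E)).det := lt_of_lt_of_le (by positivity) hda
  have hdy' : 0 < (gram ℝ fun i => (vR i : E')).det := lt_of_lt_of_le (by positivity) hdy
  have hg := gram_block (fun i => (vS i : E)) (fun j => (b (Sum.inr j) : WithLp 2 (E × E')).fst)
    (fun j => (vR j : E')) (fun s => (b s : WithLp 2 (E × E'))) hda'.ne' hdy'.ne' hb1 (by
      intro j
      rw [← hb2 j]
      rfl)
  have hcard := card_latIn _ hLK.1 W hr b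
  rw [Fintype.card_sum, Fintype.card_fin, Fintype.card_fin] at hcard
  have hpos : k + l ≠ 0 := by
    rw [← hcard]
    intro h
    exact hW (Submodule.finrank_eq_zero.1 h)
  have hcov := covol_latIn _ W b
  have hm0 := Hmin_nonneg L
  have hkey : Hmin L ^ (k + l) ≤ covol (latIn (prodLat L K) W) := by
    rw [hcov, pow_add]
    have h1 := Hmin_pow_le L hL.1 _ k vS
    have h2 : Hmin L ^ l ≤ Real.sqrt (gram ℝ fun i => (vR i : E')).det := by
      apply Real.le_sqrt_of_sq_le
      rw [← pow_mul, mul_comm, pow_mul]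
      exact (pow_le_pow_left₀ (by positivity) hm l).trans hdy
    calc _ ≤ _ := mul_le_mul h1 h2 (by positivity) (Real.sqrt_nonneg _)
      _ = _ := (Real.sqrt_mul hda'.le _).symm
      _ ≤ _ := Real.sqrt_le_sqrt hg
  unfold Hr redH
  rw [hcard, ← Real.pow_rpow_inv_natCast hm0 hpos]
  exact Real.rpow_le_rpow (by positivity) hkey (by positivity)

lemma Hmin_prod {E E' : Type*} [NormedAddCommGroup E] [InnerProductSpace ℝ E]
    [FiniteDimensional ℝ E] [Nontrivial E]
    [NormedAddCommGroup E'] [InnerProductSpace ℝ E'] [FiniteDimensional ℝ E']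
    (L : Submodule ℤ E) (K : Submodule ℤ E')
    (hL : IsLat L) (hK : IsLat K) (ε ε' : ℝ) (hε : 0 < ε) (hε' : 0 < ε')
    (hLb : GramBd L ε') (hKb : GramBd K ε) (hm : Hmin L ^ 2 ≤ ε) :
    Hmin (prodLat L K) = Hmin L :=
  le_antisymm (Hmin_prod_le L K hL) (le_Hmin_prod L K hL hK ε ε' hε hε' hLb hKb hm)

lemma exists_real_basis {E : Type*} [NormedAddCommGroup E] [InnerProductSpace ℝ E]
    [FiniteDimensional ℝ E] (L : Submodule ℤ E) (hL : IsLat L) :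
    ∃ (n : ℕ) (b : Basis (Fin n) ℝ E), Submodule.span ℤ (Set.range b) = L := by
  obtain ⟨h1, h2⟩ := hL
  have : IsZLattice ℝ L := ⟨h2⟩
  let v := finBasis ℤ L
  exact ⟨_, v.ofZLatticeBasis ℝ L, v.ofZLatticeBasis_span ℝ⟩

lemma isLat_span {E : Type*} [NormedAddCommGroup E] [InnerProductSpace ℝ E] {ι : Type*} [Finite ι]
    (b : Basis ι ℝ E) : IsLat (Submodule.span ℤ (Set.range b)) :=
  ⟨inferInstance, ZSpan.span_top b⟩

/-- The inner product as a bilinear form. -/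
def innB (E : Type*) [NormedAddCommGroup E] [InnerProductSpace ℝ E] : LinearMap.BilinForm ℝ E :=
  innerₗ E

lemma innB_apply {E : Type*} [NormedAddCommGroup E] [InnerProductSpace ℝ E] (x y : E) :
    innB E x y = inner ℝ x y := rfl

lemma innB_symm {E : Type*} [NormedAddCommGroup E] [InnerProductSpace ℝ E] :
    (innB E).IsSymm := ⟨fun x y => by simp [innB_apply, real_inner_comm]⟩

lemma innB_nondeg {E : Type*} [NormedAddCommGroup E] [InnerProductSpace ℝ E] :
    (innB E).Nondegenerate := by
  constructor
  · intro x hx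
    have := hx x
    rwa [innB_apply, inner_self_eq_zero] at this
  · intro x hx
    have := hx x
    rwa [innB_apply, inner_self_eq_zero] at this

lemma dualLat_eq {E : Type*} [NormedAddCommGroup E] [InnerProductSpace ℝ E] (L : Submodule ℤ E) :
    dualLat L = (innB E).dualSubmodule L := by
  ext y
  constructor
  · intro h x hx
    obtain ⟨n, hn⟩ := h x hx
    refine Submodule.mem_one.2 ⟨n, ?_⟩
    rw [innB_apply, real_inner_comm, hn]; simp
  · intro h x hx
    obtain ⟨n, hn⟩ := Submodule.mem_one.1 (h x hx)
    refine ⟨n, ?_⟩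
    rw [innB_apply, real_inner_comm] at hn
    rw [← hn]; simp

lemma exists_dual_basis {E : Type*} [NormedAddCommGroup E] [InnerProductSpace ℝ E]
    [FiniteDimensional ℝ E] (L : Submodule ℤ E) (hL : IsLat L) :
    ∃ (n : ℕ) (b : Basis (Fin n) ℝ E), Submodule.span ℤ (Set.range b) = dualLat L := by
  obtain ⟨n, b, rfl⟩ := exists_real_basis L hL
  refine ⟨n, (innB E).dualBasis innB_nondeg b, ?_⟩
  rw [dualLat_eq, LinearMap.BilinForm.dualSubmodule_span_of_basis _ innB_nondeg]

lemma dual_dual {E : Type*} [NormedAddCommGroup E] [InnerProductSpace ℝ E]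
    [FiniteDimensional ℝ E] (L : Submodule ℤ E) (hL : IsLat L) :
    dualLat (dualLat L) = L := by
  obtain ⟨n, b, rfl⟩ := exists_real_basis L hL
  rw [dualLat_eq, dualLat_eq,
    LinearMap.BilinForm.dualSubmodule_dualSubmodule_of_basis _ innB_nondeg innB_symm]

/-- Scaled lattice. -/
def scale {E : Type*} [NormedAddCommGroup E] [InnerProductSpace ℝ E] (c : ℝ)
    (K : Submodule ℤ E) : Submodule ℤ E :=
  K.map ((c • (LinearMap.id : E →ₗ[ℝ] E)).restrictScalars ℤ)

lemma mem_scale {E : Type*} [NormedAddCommGroup E] [InnerProductSpace ℝ E] (c : ℝ)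
    (K : Submodule ℤ E) (x : E) : x ∈ scale c K ↔ ∃ y ∈ K, c • y = x := Iff.rfl

lemma exists_scale_basis {E : Type*} [NormedAddCommGroup E] [InnerProductSpace ℝ E] {ι : Type*}
    (c : ℝ) (hc : c ≠ 0) (b : Basis ι ℝ E) :
    ∃ b' : Basis ι ℝ E, Submodule.span ℤ (Set.range b') =
      scale c (Submodule.span ℤ (Set.range b)) := by
  refine ⟨b.map (LinearEquiv.smulOfNeZero ℝ E c hc), ?_⟩
  rw [scale, Submodule.map_span, ← Set.range_comp]
  rfl

open Matrix in
lemma gramBd_scale {E : Type*} [NormedAddCommGroup E] [InnerProductSpace ℝ E] (c : ℝ)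
    (K : Submodule ℤ E) (ε : ℝ) (h : GramBd K ε) :
    GramBd (scale c K) (c ^ 2 * ε) := by
  intro l y hy hli
  choose y0 hy0 hyy using hy
  have h1 : LinearIndependent ℤ y0 := by
    apply LinearIndependent.of_comp ((c • (LinearMap.id : E →ₗ[ℝ] E)).restrictScalars ℤ)
    convert hli
    ext j
    exact hyy j
  have h2 := h l y0 hy0 h1
  have h3 : gram ℝ y = c ^ 2 • gram ℝ y0 := by
    have hyy' : ∀ j, y j = c • y0 j := fun j => (hyy j).symm
    ext i j
    simp only [gram_apply, hyy', real_inner_smul_left, real_inner_smul_right, Matrix.smul_apply,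
      smul_eq_mul]
    ring
  rw [h3, det_smul, Fintype.card_fin, mul_pow]
  gcongr

section tensor

variable {E F G : Type*} [NormedAddCommGroup E] [InnerProductSpace ℝ E]
  [NormedAddCommGroup F] [InnerProductSpace ℝ F]
  [NormedAddCommGroup G] [InnerProductSpace ℝ G] (tp : E →ₗ[ℝ] F →ₗ[ℝ] G)

/-- A real bilinear map seen as a bilinear map over the integers. -/
def tpZ : E →ₗ[ℤ] F →ₗ[ℤ] G :=
  LinearMap.mk₂ ℤ (fun x y => tp x y) (by simp) (by intros; simp) (by simp) (by intros; simp)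

lemma tensorLat_eq (L : Submodule ℤ E) (M : Submodule ℤ F) :
    tensorLat tp L M = Submodule.map₂ (tpZ tp) L M := by
  rw [Submodule.map₂_eq_span_image2]; rfl

lemma tensor_mem {L : Submodule ℤ E} {M : Submodule ℤ F} {x : E} {y : F} (hx : x ∈ L)
    (hy : y ∈ M) : tp x y ∈ tensorLat tp L M :=
  Submodule.subset_span ⟨x, hx, y, hy, rfl⟩

lemma exists_tensor_basis (ht : IsTensor tp) {ι κ : Type*} (b : Basis ι ℝ E) (b' : Basis κ ℝ F) :
    ∃ d : Basis (ι × κ) ℝ G, Submodule.span ℤ (Set.range d) =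
      tensorLat tp (Submodule.span ℤ (Set.range b)) (Submodule.span ℤ (Set.range b')) := by
  refine ⟨(b.tensorProduct b').map (LinearEquiv.ofBijective _ ht.1), ?_⟩
  rw [tensorLat_eq, Submodule.map₂_span_span]
  congr 1
  ext z
  constructor
  · rintro ⟨⟨i, j⟩, rfl⟩
    refine ⟨b i, ⟨i, rfl⟩, b' j, ⟨j, rfl⟩, ?_⟩
    simp [tpZ]
  · rintro ⟨_, ⟨i, rfl⟩, _, ⟨j, rfl⟩, rfl⟩
    refine ⟨(i, j), ?_⟩
    simp [tpZ]

lemma tensor_scale (c : ℝ) (K : Submodule ℤ E) (M : Submodule ℤ F) :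
    tensorLat tp (scale c K) M = scale c (tensorLat tp K M) := by
  rw [scale, tensorLat, tensorLat, scale, Submodule.map_span]
  congr 1
  ext z
  constructor
  · rintro ⟨_, ⟨x, hx, rfl⟩, y, hy, rfl⟩
    exact ⟨tp x y, ⟨x, hx, y, hy, rfl⟩, by simp⟩
  · rintro ⟨_, ⟨x, hx, y, hy, rfl⟩, rfl⟩
    exact ⟨_, ⟨x, hx, rfl⟩, y, hy, by simp⟩

/-- Doubling of a tensor product. -/
def tp2 : WithLp 2 (E × E) →ₗ[ℝ] F →ₗ[ℝ] WithLp 2 (G × G) :=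
  LinearMap.mk₂ ℝ (fun x y => WithLp.toLp 2 (tp x.fst y, tp x.snd y))
    (by intros; simp [← WithLp.toLp_add]) (by intros; simp [← WithLp.toLp_smul])
    (by intros; simp [← WithLp.toLp_add]) (by intros; simp [← WithLp.toLp_smul])

lemma tp2_apply (x : WithLp 2 (E × E)) (y : F) :
    tp2 tp x y = WithLp.toLp 2 (tp x.fst y, tp x.snd y) := rfl

lemma tp2_tensor (ht : IsTensor tp) : IsTensor (tp2 tp) := by
  constructor
  · let e1 := TensorProduct.congr (WithLp.linearEquiv 2 ℝ (E × E)) (LinearEquiv.refl ℝ F)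
    let e2 := TensorProduct.prodLeft ℝ ℝ E E F
    let e0 := LinearEquiv.ofBijective _ ht.1
    let e3 := e0.prodCongr e0
    let e := ((e1.trans e2).trans e3).trans (WithLp.linearEquiv 2 ℝ (G × G)).symm
    have : TensorProduct.lift (tp2 tp) = e.toLinearMap := by
      apply TensorProduct.ext'
      intro x y
      obtain ⟨⟨x1, x2⟩⟩ := x
      simp [e, e1, e2, e3, e0, tp2_apply]
    rw [this]
    exact e.bijective
  · intro x x' y y'
    simp only [tp2_apply, WithLp.prod_inner_apply, ht.2, add_mul]
    rfl

lemma tp2_lat (L K : Submodule ℤ E) (M : Submodule ℤ F) :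
    tensorLat (tp2 tp) (prodLat L K) M = prodLat (tensorLat tp L M) (tensorLat tp K M) := by
  apply le_antisymm
  · rw [tensorLat, Submodule.span_le]
    rintro _ ⟨x, hx, y, hy, rfl⟩
    exact ⟨tensor_mem tp hx.1 hy, tensor_mem tp hx.2 hy⟩
  · have k1 : (tensorLat tp L M).map ((inlL G G).restrictScalars ℤ) ≤
        tensorLat (tp2 tp) (prodLat L K) M := by
      rw [tensorLat, Submodule.map_span, Submodule.span_le]
      rintro _ ⟨_, ⟨x, hx, y, hy, rfl⟩, rfl⟩
      have := tensor_mem (tp2 tp) ((inl_mem L K x).2 hx) hy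
      rw [tp2_apply] at this
      simpa [inlL_apply] using this
    have k2 : (tensorLat tp K M).map ((inrL G G).restrictScalars ℤ) ≤
        tensorLat (tp2 tp) (prodLat L K) M := by
      rw [tensorLat, Submodule.map_span, Submodule.span_le]
      rintro _ ⟨_, ⟨x, hx, y, hy, rfl⟩, rfl⟩
      have := tensor_mem (tp2 tp) ((inr_mem L K x).2 hx) hy
      rw [tp2_apply] at this
      simpa [inrL_apply] using this
    intro z hz
    rw [← inl_add_inr z]
    exact add_mem (k1 ⟨_, hz.1, rfl⟩) (k2 ⟨_, hz.2, rfl⟩)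

end tensor

/-- The (twisted) swap map. -/
def swapL (E : Type*) [NormedAddCommGroup E] [InnerProductSpace ℝ E] (s c : ℝ) :
    WithLp 2 (E × E) →ₗ[ℝ] WithLp 2 (E × E) where
  toFun z := WithLp.toLp 2 ((s * c⁻¹) • z.snd, c⁻¹ • z.fst)
  map_add' x y := by simp [← WithLp.toLp_add]
  map_smul' a x := by
    simp only [← WithLp.toLp_smul, WithLp.smul_snd, WithLp.smul_fst, RingHom.id_apply,
      Prod.smul_mk]
    rw [smul_comm, smul_comm c⁻¹]

lemma swapL_fst {E : Type*} [NormedAddCommGroup E] [InnerProductSpace ℝ E] (s c : ℝ)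
    (z : WithLp 2 (E × E)) : (swapL E s c z).fst = (s * c⁻¹) • z.snd := rfl

lemma swapL_snd {E : Type*} [NormedAddCommGroup E] [InnerProductSpace ℝ E] (s c : ℝ)
    (z : WithLp 2 (E × E)) : (swapL E s c z).snd = c⁻¹ • z.fst := rfl

lemma inner_prod {E : Type*} [NormedAddCommGroup E] [InnerProductSpace ℝ E]
    (x y : WithLp 2 (E × E)) :
    inner ℝ x y = inner ℝ x.fst y.fst + inner ℝ x.snd y.snd := rfl

lemma swap_isodual {E : Type*} [NormedAddCommGroup E] [InnerProductSpace ℝ E]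
    [FiniteDimensional ℝ E] (L : Submodule ℤ E) (hL : IsLat L) (s c : ℝ) (hs : s = 1 ∨ s = -1)
    (hc : 0 < c) : IsIsodual (prodLat L (scale c (dualLat L))) (swapL E s c) := by
  have hs2 : s * s = 1 := by rcases hs with rfl | rfl <;> norm_num
  have hsm : ∀ (S : Submodule ℤ E) (x : E), x ∈ S → s • x ∈ S := by
    intro S x hx
    rcases hs with rfl | rfl
    · simpa using hx
    · simpa using hx
  refine ⟨⟨c⁻¹ ^ 2, by positivity, ?_⟩, ?_⟩
  · intro x y
    simp only [inner_prod, swapL_fst, swapL_snd,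
      real_inner_smul_left, real_inner_smul_right]
    linear_combination (c⁻¹ ^ 2 * inner ℝ x.snd y.snd) * hs2
  · apply le_antisymm
    · rintro _ ⟨z, ⟨hz1, ⟨y, hy, hyz⟩⟩, rfl⟩
      rintro w ⟨hw1, ⟨v, hv, hvw⟩⟩
      change c • y = z.snd at hyz
      change c • v = w.snd at hvw
      obtain ⟨n1, hn1⟩ := hsm _ _ hy _ hw1
      obtain ⟨n2, hn2⟩ := hv _ hz1
      refine ⟨n1 + n2, ?_⟩
      change inner ℝ w (swapL E s c z) = _
      change inner ℝ w.fst (s • y) = _ at hn1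
      change inner ℝ z.fst v = _ at hn2
      simp only [inner_prod, swapL_fst, swapL_snd, ← hyz, ← hvw]
      rw [smul_smul, mul_assoc, inv_mul_cancel₀ hc.ne', mul_one, hn1, real_inner_smul_left,
        real_inner_smul_right, mul_inv_cancel_left₀ hc.ne', real_inner_comm, hn2]
      push_cast; ring
    · intro w hw
      have h1 : w.fst ∈ dualLat L := by
        intro x hx
        obtain ⟨n, hn⟩ := hw _ ((inl_mem L (scale c (dualLat L)) x).2 hx)
        refine ⟨n, ?_⟩
        rw [← hn]
        simp [inlL_apply, WithLp.prod_inner_apply]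
      have h2 : c • w.snd ∈ L := by
        rw [← dual_dual L hL]
        intro x hx
        obtain ⟨n, hn⟩ := hw _ ((inr_mem L (scale c (dualLat L)) (c • x)).2 ⟨x, hx, rfl⟩)
        refine ⟨n, ?_⟩
        rw [← hn]
        simp [inrL_apply, WithLp.prod_inner_apply, real_inner_smul_left, real_inner_smul_right]
      refine ⟨WithLp.toLp 2 (c • w.snd, c • s • w.fst), ⟨h2, ⟨s • w.fst, hsm _ _ h1, rfl⟩⟩, ?_⟩
      apply (WithLp.equiv 2 (E × E)).injective
      refine Prod.ext ?_ ?_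
      · change (s * c⁻¹) • (c • s • w.fst) = w.fst
        rw [smul_smul, smul_smul, mul_assoc s, inv_mul_cancel₀ hc.ne', mul_one, hs2, one_smul]
      · change c⁻¹ • (c • w.snd) = w.snd
        rw [smul_smul, inv_mul_cancel₀ hc.ne', one_smul]

lemma Hmin_subsingleton {E : Type*} [NormedAddCommGroup E] [InnerProductSpace ℝ E]
    [Subsingleton E] (L : Submodule ℤ E) : Hmin L = 0 := by
  unfold Hmin
  convert Real.sInf_empty
  ext h
  simp only [Set.mem_ofPred_eq, Set.mem_empty_iff_false, iff_false]
  rintro ⟨F, hF, -⟩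
  exact hF (Subsingleton.elim _ _)

open Classical in
lemma main_aux.{u, v, w} {F : Type v} [NormedAddCommGroup F] [InnerProductSpace ℝ F]
    [FiniteDimensional ℝ F] (M : Submodule ℤ F) (hM : IsLat M) (s : ℝ) (hs : s = 1 ∨ s = -1)
    (H : ∀ (E : Type u) [NormedAddCommGroup E] [InnerProductSpace ℝ E] [FiniteDimensional ℝ E]
        (L : Submodule ℤ (WithLp 2 (E × E))) (c : ℝ), IsLat L → IsIsodual L (swapL E s c) →
        ∀ (G : Type w) [NormedAddCommGroup G] [InnerProductSpace ℝ G]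
          (tp : (WithLp 2 (E × E)) →ₗ[ℝ] F →ₗ[ℝ] G), IsTensor tp →
          Hmin (tensorLat tp L M) = Hmin L * Hmin M)
    (E : Type u) [NormedAddCommGroup E] [InnerProductSpace ℝ E] [FiniteDimensional ℝ E]
    (L : Submodule ℤ E) (hL : IsLat L)
    (G : Type w) [NormedAddCommGroup G] [InnerProductSpace ℝ G]
    (tp : E →ₗ[ℝ] F →ₗ[ℝ] G) (ht : IsTensor tp) :
    Hmin (tensorLat tp L M) = Hmin L * Hmin M := by
  rcases subsingleton_or_nontrivial E with hE | hE
  · have : Subsingleton G := (LinearEquiv.ofBijective _ ht.1).symm.toEquiv.subsingleton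
    simp [Hmin_subsingleton]
  rcases subsingleton_or_nontrivial F with hF | hF
  · have : Subsingleton G := (LinearEquiv.ofBijective _ ht.1).symm.toEquiv.subsingleton
    simp [Hmin_subsingleton]
  have : Nontrivial G := (LinearEquiv.ofBijective _ ht.1).symm.toEquiv.nontrivial
  obtain ⟨n, b, hb⟩ := exists_real_basis L hL
  obtain ⟨n', d, hd⟩ := exists_dual_basis L hL
  obtain ⟨k, f, hf⟩ := exists_real_basis M hM
  obtain ⟨g, hg⟩ := exists_tensor_basis tp ht b f
  obtain ⟨g', hg'⟩ := exists_tensor_basis tp ht d f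
  rw [hb, hf] at hg
  rw [hd, hf] at hg'
  have : FiniteDimensional ℝ G := g.finiteDimensional_of_finite
  obtain ⟨ε1, hε1, hB1⟩ := exists_gramBd b L hb.ge
  obtain ⟨ε2, hε2, hB2⟩ := exists_gramBd d _ hd.ge
  obtain ⟨ε3, hε3, hB3⟩ := exists_gramBd g _ hg.ge
  obtain ⟨ε4, hε4, hB4⟩ := exists_gramBd g' _ hg'.ge
  obtain ⟨c, hc1, hc2, hc⟩ : ∃ c : ℝ, Hmin L ^ 2 ≤ c ^ 2 * ε2 ∧
      Hmin (tensorLat tp L M) ^ 2 ≤ c ^ 2 * ε4 ∧ 0 < c := by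
    let p := Hmin L ^ 2 / ε2
    let q := Hmin (tensorLat tp L M) ^ 2 / ε4
    have hp : 0 ≤ p := by positivity
    have hq : 0 ≤ q := by positivity
    refine ⟨1 + p + q, ?_, ?_, by positivity⟩
    · rw [← div_le_iff₀ hε2]
      change p ≤ _
      nlinarith
    · rw [← div_le_iff₀ hε4]
      change q ≤ _
      nlinarith
  have hLM : IsLat (tensorLat tp L M) := hg ▸ isLat_span g
  have hK : IsLat (scale c (dualLat L)) := by
    obtain ⟨d', hd'⟩ := exists_scale_basis c hc.ne' d
    rw [hd] at hd'
    exact hd' ▸ isLat_span d'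
  have hKM : IsLat (scale c (tensorLat tp (dualLat L) M)) := by
    obtain ⟨d', hd'⟩ := exists_scale_basis c hc.ne' g'
    rw [hg'] at hd'
    exact hd' ▸ isLat_span d'
  have e1 := Hmin_prod L (scale c (dualLat L)) hL hK (c ^ 2 * ε2) ε1 (by positivity) hε1 hB1
    (gramBd_scale c _ _ hB2) hc1
  have e2 := Hmin_prod (tensorLat tp L M) (scale c (tensorLat tp (dualLat L) M)) hLM hKM
    (c ^ 2 * ε4) ε3 (by positivity) hε3 hB3 (gramBd_scale c _ _ hB4) hc2
  have e3 := H E (prodLat L (scale c (dualLat L))) c (isLat_prodLat _ _ hL hK)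
    (swap_isodual L hL s c hs hc) _ (tp2 tp) (tp2_tensor tp ht)
  rw [tp2_lat, tensor_scale, e1, e2] at e3
  exact e3

lemma swap_symm {E : Type*} [NormedAddCommGroup E] [InnerProductSpace ℝ E] (c : ℝ)
    (x y : WithLp 2 (E × E)) : bform (swapL E 1 c) x y = bform (swapL E 1 c) y x := by
  simp only [bform, inner_prod, swapL_fst, swapL_snd,
    real_inner_smul_left]
  rw [real_inner_comm x.fst, real_inner_comm x.snd]
  ring

lemma swap_alt {E : Type*} [NormedAddCommGroup E] [InnerProductSpace ℝ E] (c : ℝ)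
    (x : WithLp 2 (E × E)) : bform (swapL E (-1) c) x x = 0 := by
  simp only [bform, inner_prod, swapL_fst, swapL_snd,
    real_inner_smul_left]
  rw [real_inner_comm x.fst]
  ring

/-- If a Euclidean lattice `(F, M)` satisfies tensor multiplicativity of
`H_min` against all orthogonal isodual lattices (or all symplectic isodual lattices, or all
isodual lattices), then it satisfies it against all Euclidean lattices. -/
theorem statement14.{u, v, w} {F : Type v} [NormedAddCommGroup F] [InnerProductSpace ℝ F]
    [FiniteDimensional ℝ F] (M : Submodule ℤ F) (hM : IsLat M)
    (H :
      (∀ (E : Type u) [NormedAddCommGroup E] [InnerProductSpace ℝ E] [FiniteDimensional ℝ E]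
        (L : Submodule ℤ E) (τ : E →ₗ[ℝ] E), IsLat L → IsIsodual L τ →
        (∀ x y, bform τ x y = bform τ y x) →
        ∀ (G : Type w) [NormedAddCommGroup G] [InnerProductSpace ℝ G]
          (tp : E →ₗ[ℝ] F →ₗ[ℝ] G), IsTensor tp →
          Hmin (tensorLat tp L M) = Hmin L * Hmin M) ∨
      (∀ (E : Type u) [NormedAddCommGroup E] [InnerProductSpace ℝ E] [FiniteDimensional ℝ E]
        (L : Submodule ℤ E) (τ : E →ₗ[ℝ] E), IsLat L → IsIsodual L τ →
        (∀ x : E, bform τ x x = 0) →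
        ∀ (G : Type w) [NormedAddCommGroup G] [InnerProductSpace ℝ G]
          (tp : E →ₗ[ℝ] F →ₗ[ℝ] G), IsTensor tp →
          Hmin (tensorLat tp L M) = Hmin L * Hmin M) ∨
      (∀ (E : Type u) [NormedAddCommGroup E] [InnerProductSpace ℝ E] [FiniteDimensional ℝ E]
        (L : Submodule ℤ E), IsLat L → (∃ τ : E →ₗ[ℝ] E, IsIsodual L τ) →
        ∀ (G : Type w) [NormedAddCommGroup G] [InnerProductSpace ℝ G]
          (tp : E →ₗ[ℝ] F →ₗ[ℝ] G), IsTensor tp →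
          Hmin (tensorLat tp L M) = Hmin L * Hmin M)) :
    ∀ (E : Type u) [NormedAddCommGroup E] [InnerProductSpace ℝ E] [FiniteDimensional ℝ E]
      (L : Submodule ℤ E), IsLat L →
      ∀ (G : Type w) [NormedAddCommGroup G] [InnerProductSpace ℝ G]
        (tp : E →ₗ[ℝ] F →ₗ[ℝ] G), IsTensor tp →
        Hmin (tensorLat tp L M) = Hmin L * Hmin M := by
  intro E _ _ _ L hL G _ _ tp ht
  rcases H with H | H | H
  · refine main_aux M hM 1 (Or.inl rfl) ?_ E L hL G tp ht
    intro E _ _ _ L c hL hi G _ _ tp ht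
    exact H _ L _ hL hi (swap_symm c) G tp ht
  · refine main_aux M hM (-1) (Or.inr rfl) ?_ E L hL G tp ht
    intro E _ _ _ L c hL hi G _ _ tp ht
    exact H _ L _ hL hi (swap_alt c) G tp ht
  · refine main_aux M hM 1 (Or.inl rfl) ?_ E L hL G tp ht
    intro E _ _ _ L c hL hi G _ _ tp ht
    exact H _ L hL ⟨_, hi⟩ G tp ht

end EucLat
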